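/- arXiv:math/0503456 — 2 statements merged into one kernel-verified Lean document; each statement's English description precedes it below -/
import Mathlib

section
/- Let F be a field, let m ≥ 1 be an integer, let v, t_1, …, t_{m+1} be nonzero elements of F with v^2 ≠ 1, and let a_1, …, a_m, b_1, …, b_{m-1}, c_1, …, c_{m+1} be integers. Set B = b_1 + … + b_{m-1}, A = a_1 + … + a_m, C = c_1 + … + c_{m+1}, and s_j = t_j^2 v^{-2a_j} for 1 ≤ j ≤ m. Assume that the s_j are pairwise distinct and that s_k ≠ v^2 s_j for all j ≠ k. Then ((t_m t_{m+1}^{-1} v^{B-2A+C-1} − t_m^{-1} t_{m+1} v^{-B+2A-C+1})/(v − v^{-1})) · (1 − v^2)^2 · v^{B−C} · t_m t_{m+1} = Σ_{j=1}^{m} t_j^2 v^{-2a_j+2} (1 − t_m^2 t_j^{-2} v^{2a_j − 2c_m})(1 − t_{m+1}^2 t_j^{-2} v^{2a_j − 2c_{m+1}}) · ∏_{k ≤ m, k ≠ j} (1 − t_k^2 t_j^{-2} v^{2a_j − 2a_k})^{-1} (1 − t_j^2 t_k^{-2} v^{2a_k − 2a_j + 2})^{-1} · ∏_{k=1}^{m-1}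 (1 − t_k^2 t_j^{-2} v^{2a_j − 2c_k})(1 − t_j^2 t_k^{-2} v^{2b_k − 2a_j + 2}) − Σ_{j=1}^{m} t_j^2 v^{-2a_j} (1 − t_m^2 t_j^{-2} v^{2a_j − 2c_m + 2})(1 − t_{m+1}^2 t_j^{-2} v^{2a_j − 2c_{m+1} + 2}) · ∏_{k ≤ m, k ≠ j} (1 − t_k^2 t_j^{-2} v^{2a_j − 2a_k + 2})^{-1} (1 − t_j^2 t_k^{-2} v^{2a_k − 2a_j})^{-1} · ∏_{k=1}^{m-1} (1 − t_k^2 t_j^{-2} v^{2a_j − 2c_k + 2})(1 − t_j^2 t_k^{-2} v^{2b_k − 2a_j}). -/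
open Finset

lemma core_sum {F : Type*} [Field F] (I : Finset ℕ) (s : ℕ → F) (q : F) (hq0 : q ≠ 0) (hq1 : q ≠ 1)
    (h0 : ∀ j ∈ I, s j ≠ 0)
    (hdist : ∀ j ∈ I, ∀ k ∈ I, j ≠ k → s j ≠ s k)
    (hq : ∀ j ∈ I, ∀ k ∈ I, j ≠ k → s k ≠ q * s j)
    (P : Polynomial F) (hP : P.Monic) (hd : P.natDegree = I.card + I.card) :
    1 = P.eval 0 / ((∏ k ∈ I, (0 - s k)) * ∏ k ∈ I, (0 - s k / q))
      + ((∑ j ∈ I, P.eval (s j) / (s j * ((∏ k ∈ I.erase j, (s j - s k)) * ∏ k ∈ I, (s j - s k / q))))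
      + ∑ j ∈ I, P.eval (s j / q) / (s j / q * ((∏ k ∈ I, (s j / q - s k)) *
          ∏ k ∈ I.erase j, (s j / q - s k / q)))) := by
  classical
  let w : Option (ℕ ⊕ ℕ) → F := fun o => o.elim 0 (Sum.elim s (fun k => s k / q))
  let N : Finset (Option (ℕ ⊕ ℕ)) := insertNone (I.disjSum I)
  have hq' : ∀ j ∈ I, ∀ k ∈ I, s k ≠ q * s j := by
    intro j hj k hk
    by_cases h : j = k
    · subst h
      intro e
      apply hq1
      have := h0 j hj
      field_simp at e
      exact e.symm
    · exact hq j hj k hk h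
  have hinj : Set.InjOn w N := by
    rintro (_ | x | x) hx (_ | y | y) hy h <;> simp [N, w] at hx hy h ⊢
    · exact h0 y hy h.symm
    · exact div_ne_zero (h0 y hy) hq0 h.symm
    · exact h0 x hx h
    · by_contra hc
      exact hdist x hx y hy hc h
    · apply hq' x hx y hy
      rw [h]; field_simp
    · rcases h with h | h
      · exact h0 x hx h
      · exact hq0 h
    · apply hq' y hy x hx
      rw [← h]; field_simp
    · by_contra hc
      apply hdist x hx y hy hc
      field_simp at h
      exact h
  have hdeg : (N.card : WithBot ℕ) = P.degree + 1 := by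
    rw [Polynomial.degree_eq_natDegree hP.ne_zero, hd]
    simp [N]
  have key := Lagrange.leadingCoeff_eq_sum hinj hdeg
  rw [hP.leadingCoeff] at key
  have e0 : N.erase none = (I.disjSum I).map Function.Embedding.some := by
    ext (_ | x) <;> simp [N]
  have e1 : ∀ j, N.erase (some (Sum.inl j)) = insertNone ((I.erase j).disjSum I) := by
    intro j
    ext (_ | x | x) <;> simp [N]
  have e2 : ∀ j, N.erase (some (Sum.inr j)) = insertNone (I.disjSum (I.erase j)) := by
    intro j
    ext (_ | x | x) <;> simp [N]
  have hN : ∀ f : Option (ℕ ⊕ ℕ) → F, ∑ i ∈ N, f i = f none + ((∑ j ∈ I, f (some (Sum.inl j))) + ∑ j ∈ I, f (some (Sum.inr j))) := by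
    intro f
    simp [N, Finset.sum_disjSum]
  rw [hN] at key
  simp only [e0, e1, e2, prod_insertNone, prod_disjSum, prod_map] at key
  simpa [w] using key

lemma core_id {F : Type*} [Field F] (n : ℕ) (I J L : Finset ℕ) (s y z : ℕ → F) (q : F)
    (hI : I.card = n + 1) (hJ : J.card = n) (hL : L.card = n + 2)
    (hq0 : q ≠ 0) (hq1 : q ≠ 1)
    (h0 : ∀ j ∈ I, s j ≠ 0) (hz : ∀ j ∈ J, z j ≠ 0)
    (hdist : ∀ j ∈ I, ∀ k ∈ I, j ≠ k → s j ≠ s k)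
    (hq : ∀ j ∈ I, ∀ k ∈ I, j ≠ k → s k ≠ q * s j) :
    q * (1 - q) * ((∏ k ∈ L, y k) / (∏ k ∈ I, s k)) - (1 - q) * ((∏ k ∈ I, s k) / ∏ k ∈ J, z k)
     = (∑ j ∈ I, s j * q * (∏ k ∈ L, (1 - y k / s j)) *
        (∏ k ∈ I.erase j, ((1 - s k / s j)⁻¹ * (1 - q * (s j / s k))⁻¹)) *
        ∏ k ∈ J, (1 - q * (s j / z k)))
      - ∑ j ∈ I, s j * (∏ k ∈ L, (1 - q * (y k / s j))) *
        (∏ k ∈ I.erase j, ((1 - q * (s k / s j))⁻¹ * (1 - (s j / s k))⁻¹)) *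
        ∏ k ∈ J, (1 - (s j / z k)) := by
  classical
  let P : Polynomial F := (∏ k ∈ L, (Polynomial.X - Polynomial.C (y k))) *
    ∏ k ∈ J, (Polynomial.X - Polynomial.C (z k / q))
  have m1 : (∏ k ∈ L, (Polynomial.X - Polynomial.C (y k))).Monic :=
    Polynomial.monic_prod_of_monic _ _ fun k _ => Polynomial.monic_X_sub_C _
  have m2 : (∏ k ∈ J, (Polynomial.X - Polynomial.C (z k / q))).Monic :=
    Polynomial.monic_prod_of_monic _ _ fun k _ => Polynomial.monic_X_sub_C _
  have hP : P.Monic := m1.mul m2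
  have hd : P.natDegree = I.card + I.card := by
    simp only [P]
    rw [m1.natDegree_mul m2, Polynomial.natDegree_finsetProd_X_sub_C_eq_card,
      Polynomial.natDegree_finsetProd_X_sub_C_eq_card]
    omega
  have hev : ∀ x, P.eval x = (∏ k ∈ L, (x - y k)) * ∏ k ∈ J, (x - z k / q) := by
    intro x
    simp [P, Polynomial.eval_prod]
  have key := core_sum I s q hq0 hq1 h0 hdist hq P hP hd
  simp only [hev] at key
  set S := ∏ k ∈ I, s k with hS
  set Z := ∏ k ∈ J, z k with hZ
  have hS0 : S ≠ 0 := prod_ne_zero_iff.mpr h0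
  have hZ0 : Z ≠ 0 := prod_ne_zero_iff.mpr hz
  have hq1' : 1 - q ≠ 0 := sub_ne_zero.mpr (Ne.symm hq1)
  have t0 : ((∏ k ∈ L, (0 - y k)) * ∏ k ∈ J, (0 - z k / q)) /
      ((∏ k ∈ I, (0 - s k)) * ∏ k ∈ I, (0 - s k / q)) = (∏ k ∈ L, y k) * Z * q / S ^ 2 := by
    simp only [zero_sub, prod_neg, prod_div_distrib, prod_const, hI, hJ, hL, ← hS, ← hZ]
    field_simp
    ring_nf
    try simp [pow_mul]
  have cardE : ∀ j ∈ I, (I.erase j).card = n := by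
    intro j hj; rw [card_erase_of_mem hj, hI]; rfl
  have prodE : ∀ j ∈ I, ∏ k ∈ I.erase j, s k = S / s j := by
    intro j hj
    rw [eq_div_iff (h0 j hj), hS, prod_erase_mul _ _ hj]
  have t1 : ∀ j ∈ I, s j * q * (∏ k ∈ L, (1 - y k / s j)) *
        (∏ k ∈ I.erase j, ((1 - s k / s j)⁻¹ * (1 - q * (s j / s k))⁻¹)) *
        ∏ k ∈ J, (1 - q * (s j / z k)) = -(1 - q) * (S / Z) *
        (((∏ k ∈ L, (s j - y k)) * ∏ k ∈ J, (s j - z k / q)) /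
          (s j * ((∏ k ∈ I.erase j, (s j - s k)) * ∏ k ∈ I, (s j - s k / q)))) := by
    intro j hj
    have hj0 := h0 j hj
    have a1 : ∏ k ∈ L, (1 - y k / s j) = (∏ k ∈ L, (s j - y k)) / s j ^ (n + 2) := by
      rw [← hL, ← prod_const, ← prod_div_distrib]
      refine prod_congr rfl fun k _ => ?_
      field_simp
    have a2 : ∏ k ∈ J, (1 - q * (s j / z k)) = (-q) ^ n / Z * ∏ k ∈ J, (s j - z k / q) := by
      rw [← hJ, ← prod_const, hZ, ← prod_div_distrib, ← prod_mul_distrib]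
      refine prod_congr rfl fun k hk => ?_
      have := hz k hk
      field_simp
      ring
    have a3 : ∏ k ∈ I.erase j, ((1 - s k / s j)⁻¹ * (1 - q * (s j / s k))⁻¹)
        = s j ^ n * (S / s j) * ((-q) ^ n)⁻¹ *
          ((∏ k ∈ I.erase j, (s j - s k)) * ∏ k ∈ I.erase j, (s j - s k / q))⁻¹ := by
      rw [← prodE j hj, ← cardE j hj, ← prod_const, ← prod_const, ← prod_inv_distrib,
        ← prod_mul_distrib, ← prod_mul_distrib, ← prod_mul_distrib, ← prod_inv_distrib,
        ← prod_mul_distrib]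
      refine prod_congr rfl fun k hk => ?_
      have hk0 := h0 k (mem_of_mem_erase hk)
      rw [show 1 - s k / s j = (s j - s k) * (s j)⁻¹ by field_simp,
        show 1 - q * (s j / s k) = (s j - s k / q) * (-q) * (s k)⁻¹ by field_simp; ring]
      simp only [mul_inv, inv_inv]
      ring
    have a4 : ∏ k ∈ I, (s j - s k / q) = (s j - s j / q) * ∏ k ∈ I.erase j, (s j - s k / q) :=
      (mul_prod_erase _ _ hj).symm
    have a5 : (s j - s j / q) = - (1 - q) * s j / q := by field_simp; ring
    rw [a1, a2, a3, a4, a5]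
    have : (-q) ^ n ≠ 0 := pow_ne_zero _ (neg_ne_zero.mpr hq0)
    generalize (-q) ^ n = e at *
    simp only [div_eq_mul_inv, mul_inv]
    generalize (∏ k ∈ I.erase j, (s j - s k))⁻¹ = p1
    generalize (∏ k ∈ I.erase j, (s j - s k * q⁻¹))⁻¹ = p2
    have : -(1-q) ≠ 0 := neg_ne_zero.mpr hq1'
    generalize -(1-q) = r at *
    field_simp
    ring
  have t2 : ∀ j ∈ I, s j * (∏ k ∈ L, (1 - q * (y k / s j))) *
        (∏ k ∈ I.erase j, ((1 - q * (s k / s j))⁻¹ * (1 - (s j / s k))⁻¹)) *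
        ∏ k ∈ J, (1 - (s j / z k)) = (1 - q) * (S / Z) *
        (((∏ k ∈ L, (s j / q - y k)) * ∏ k ∈ J, (s j / q - z k / q)) /
          (s j / q * ((∏ k ∈ I, (s j / q - s k)) * ∏ k ∈ I.erase j, (s j / q - s k / q)))) := by
    intro j hj
    have hj0 := h0 j hj
    have a1 : ∏ k ∈ L, (1 - q * (y k / s j)) = (∏ k ∈ L, (s j / q - y k)) / (s j / q) ^ (n + 2) := by
      rw [← hL, ← prod_const, ← prod_div_distrib]
      refine prod_congr rfl fun k _ => ?_
      field_simp
    have a2 : ∏ k ∈ J, (1 - (s j / z k)) = (-q) ^ n / Z * ∏ k ∈ J, (s j / q - z k / q) := by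
      rw [← hJ, ← prod_const, hZ, ← prod_div_distrib, ← prod_mul_distrib]
      refine prod_congr rfl fun k hk => ?_
      have := hz k hk
      field_simp
      ring
    have a3 : ∏ k ∈ I.erase j, ((1 - q * (s k / s j))⁻¹ * (1 - (s j / s k))⁻¹)
        = (s j / q) ^ n * (S / s j) * ((-q) ^ n)⁻¹ *
          ((∏ k ∈ I.erase j, (s j / q - s k)) * ∏ k ∈ I.erase j, (s j / q - s k / q))⁻¹ := by
      rw [← prodE j hj, ← cardE j hj, ← prod_const, ← prod_const, ← prod_inv_distrib,
        ← prod_mul_distrib, ← prod_mul_distrib, ← prod_mul_distrib, ← prod_inv_distrib,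
        ← prod_mul_distrib]
      refine prod_congr rfl fun k hk => ?_
      have hk0 := h0 k (mem_of_mem_erase hk)
      rw [show 1 - q * (s k / s j) = (s j / q - s k) * (s j / q)⁻¹ by field_simp,
        show 1 - (s j / s k) = (s j / q - s k / q) * (-q) * (s k)⁻¹ by field_simp; ring]
      simp only [mul_inv, inv_inv]
      ring
    have a4 : ∏ k ∈ I, (s j / q - s k) = (s j / q - s j) * ∏ k ∈ I.erase j, (s j / q - s k) :=
      (mul_prod_erase _ _ hj).symm
    have a5 : (s j / q - s j) = (1 - q) * s j / q := by field_simp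
    rw [a1, a2, a3, a4, a5]
    have : (-q) ^ n ≠ 0 := pow_ne_zero _ (neg_ne_zero.mpr hq0)
    generalize (-q) ^ n = e at *
    simp only [div_eq_mul_inv, mul_inv]
    generalize (∏ k ∈ I.erase j, (s j * q⁻¹ - s k))⁻¹ = p1
    generalize (∏ k ∈ I.erase j, (s j * q⁻¹ - s k * q⁻¹))⁻¹ = p2
    generalize (1-q) = r at *
    have hg : (s j * q⁻¹) ^ n ≠ 0 := pow_ne_zero _ (mul_ne_zero hj0 (inv_ne_zero hq0))
    rw [pow_add]
    generalize (s j * q⁻¹) ^ n = g at *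
    field_simp
  rw [sum_congr rfl t1, sum_congr rfl t2, ← mul_sum, ← mul_sum]
  rw [t0] at key
  generalize (∑ j ∈ I, _ : F) = X1 at *
  generalize (∑ j ∈ I, _ : F) = X2 at *
  have : X1 + X2 = 1 - (∏ k ∈ L, y k) * Z * q / S ^ 2 := by
    rw [key]; ring
  calc _ = -(1 - q) * (S / Z) * (1 - (∏ k ∈ L, y k) * Z * q / S ^ 2) := by
        field_simp
        ring
    _ = _ := by rw [← this]; ring

/-- The rational-function identity of Proposition 2.14 ('mrak') of
Braverman–Finkelberg, expressing the quantum group commutation relation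
`[E_i, F_i] = (K_i - K_i⁻¹)/(v - v⁻¹)` on the localized equivariant
K-theory of Laumon spaces. Here `m` plays the role of the index `i`,
`a j = d_{i,j}`, `b k = d_{i-1,k}`, `c k = d_{i+1,k}`, `A = d_i`,
`B = d_{i-1}`, `C = d_{i+1}`, and `s j = t_j² v^{-2 a_j}`. -/
theorem stmt_0 (F : Type*) [Field F] (m : ℕ) (hm : 1 ≤ m)
    (v : F) (t : ℕ → F) (hv : v ≠ 0) (hv2 : v ^ 2 ≠ 1)
    (ht : ∀ j ∈ Finset.Icc 1 (m + 1), t j ≠ 0)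
    (a b c : ℕ → ℤ) (A B C : ℤ)
    (hA : A = ∑ j ∈ Finset.Icc 1 m, a j)
    (hB : B = ∑ k ∈ Finset.Icc 1 (m - 1), b k)
    (hC : C = ∑ k ∈ Finset.Icc 1 (m + 1), c k)
    (s : ℕ → F)
    (hs : ∀ j, s j = (t j) ^ 2 * v ^ (-(2 * a j)))
    (hdist : ∀ j ∈ Finset.Icc 1 m, ∀ k ∈ Finset.Icc 1 m, j ≠ k → s j ≠ s k)
    (hq : ∀ j ∈ Finset.Icc 1 m, ∀ k ∈ Finset.Icc 1 m, j ≠ k →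
      s k ≠ v ^ 2 * s j) :
    (t m * (t (m + 1))⁻¹ * v ^ (B - 2 * A + C - 1)
        - (t m)⁻¹ * t (m + 1) * v ^ (-B + 2 * A - C + 1)) / (v - v⁻¹) *
        (1 - v ^ 2) ^ 2 * v ^ (B - C) * t m * t (m + 1)
      = (∑ j ∈ Finset.Icc 1 m,
          (t j) ^ 2 * v ^ (-(2 * a j) + 2) *
            (1 - (t m) ^ 2 * ((t j) ^ 2)⁻¹ * v ^ (2 * a j - 2 * c m)) *
            (1 - (t (m + 1)) ^ 2 * ((t j) ^ 2)⁻¹ *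
              v ^ (2 * a j - 2 * c (m + 1))) *
            (∏ k ∈ (Finset.Icc 1 m).erase j,
              ((1 - (t k) ^ 2 * ((t j) ^ 2)⁻¹ * v ^ (2 * a j - 2 * a k))⁻¹ *
                (1 - (t j) ^ 2 * ((t k) ^ 2)⁻¹ *
                  v ^ (2 * a k - 2 * a j + 2))⁻¹)) *
            (∏ k ∈ Finset.Icc 1 (m - 1),
              ((1 - (t k) ^ 2 * ((t j) ^ 2)⁻¹ * v ^ (2 * a j - 2 * c k)) *
                (1 - (t j) ^ 2 * ((t k) ^ 2)⁻¹ *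
                  v ^ (2 * b k - 2 * a j + 2)))))
        - (∑ j ∈ Finset.Icc 1 m,
          (t j) ^ 2 * v ^ (-(2 * a j)) *
            (1 - (t m) ^ 2 * ((t j) ^ 2)⁻¹ * v ^ (2 * a j - 2 * c m + 2)) *
            (1 - (t (m + 1)) ^ 2 * ((t j) ^ 2)⁻¹ *
              v ^ (2 * a j - 2 * c (m + 1) + 2)) *
            (∏ k ∈ (Finset.Icc 1 m).erase j,
              ((1 - (t k) ^ 2 * ((t j) ^ 2)⁻¹ *
                  v ^ (2 * a j - 2 * a k + 2))⁻¹ *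
                (1 - (t j) ^ 2 * ((t k) ^ 2)⁻¹ * v ^ (2 * a k - 2 * a j))⁻¹)) *
            (∏ k ∈ Finset.Icc 1 (m - 1),
              ((1 - (t k) ^ 2 * ((t j) ^ 2)⁻¹ *
                  v ^ (2 * a j - 2 * c k + 2)) *
                (1 - (t j) ^ 2 * ((t k) ^ 2)⁻¹ *
                  v ^ (2 * b k - 2 * a j))))) := by
  obtain ⟨n, rfl⟩ : ∃ n, m = n + 1 := ⟨m - 1, by omega⟩
  simp only [Nat.add_sub_cancel] at *
  have hvz : ∀ e : ℤ, v ^ e ≠ 0 := fun e => zpow_ne_zero e hv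
  set y : ℕ → F := fun k => t k ^ 2 * v ^ (-(2 * c k)) with hy
  set z : ℕ → F := fun k => t k ^ 2 * v ^ (-(2 * b k)) with hz
  have htI : ∀ j ∈ Finset.Icc 1 (n + 1), t j ≠ 0 := fun j hj =>
    ht j (by simp only [Finset.mem_Icc] at *; omega)
  have htJ : ∀ j ∈ Finset.Icc 1 n, t j ≠ 0 := fun j hj =>
    ht j (by simp only [Finset.mem_Icc] at *; omega)
  have h0 : ∀ j ∈ Finset.Icc 1 (n + 1), s j ≠ 0 := fun j hj => by
    rw [hs]; exact mul_ne_zero (pow_ne_zero _ (htI j hj)) (hvz _)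
  have hz0 : ∀ j ∈ Finset.Icc 1 n, z j ≠ 0 := fun j hj =>
    mul_ne_zero (pow_ne_zero _ (htJ j hj)) (hvz _)
  -- ratio lemmas
  have r0 : ∀ (p r : F) (d e : ℤ), p ^ 2 * (r ^ 2)⁻¹ * v ^ (2 * e - 2 * d)
      = (p ^ 2 * v ^ (-(2 * d))) / (r ^ 2 * v ^ (-(2 * e))) := by
    intro p r d e
    rw [zpow_sub₀ hv, zpow_neg, zpow_neg]
    simp only [div_eq_mul_inv, mul_inv, inv_inv]
    ring
  have r2 : ∀ (p r : F) (d e : ℤ), p ^ 2 * (r ^ 2)⁻¹ * v ^ (2 * e - 2 * d + 2)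
      = v ^ 2 * ((p ^ 2 * v ^ (-(2 * d))) / (r ^ 2 * v ^ (-(2 * e)))) := by
    intro p r d e
    rw [← r0, zpow_add₀ hv]
    norm_cast
    ring
  have r3 : ∀ e : ℤ, v ^ (-(2 * e) + 2) = v ^ (-(2 * e)) * v ^ 2 := by
    intro e
    rw [zpow_add₀ hv]; norm_cast
  have zprod : ∀ (K : Finset ℕ) (f : ℕ → ℤ), ∏ k ∈ K, v ^ (-(2 * f k)) = v ^ (-(2 * ∑ k ∈ K, f k)) := by
    intro K f
    induction K using Finset.induction_on with
    | empty => simp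
    | insert x K hx ih =>
      rw [prod_insert hx, sum_insert hx, ih, ← zpow_add₀ hv]
      congr 1; ring
  have key := core_id n (Finset.Icc 1 (n + 1)) (Finset.Icc 1 n) (Finset.Icc 1 (n + 1 + 1)) s y z (v ^ 2)
    (by simp) (by simp) (by simp) (pow_ne_zero 2 hv) hv2 h0 hz0 hdist hq
  have hL : ∀ f : ℕ → F, ∏ k ∈ Finset.Icc 1 (n + 1 + 1), f k
      = (∏ k ∈ Finset.Icc 1 n, f k) * f (n + 1) * f (n + 1 + 1) := by
    intro f
    rw [Finset.prod_Icc_succ_top (by omega), Finset.prod_Icc_succ_top (by omega)]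
  simp only [r0, r2, r3, ← hs]
  refine Eq.trans ?_ (key.trans ?_)
  · have eS : ∏ k ∈ Finset.Icc 1 (n + 1), s k
        = (∏ k ∈ Finset.Icc 1 n, t k) ^ 2 * t (n + 1) ^ 2 * v ^ (-(2 * A)) := by
      simp only [hs]
      rw [prod_mul_distrib, zprod, ← hA, Finset.prod_Icc_succ_top (by omega), prod_pow]
    have eZ : ∏ k ∈ Finset.Icc 1 n, z k = (∏ k ∈ Finset.Icc 1 n, t k) ^ 2 * v ^ (-(2 * B)) := by
      simp only [hz]
      rw [prod_mul_distrib, zprod, ← hB, prod_pow]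
    have eY : ∏ k ∈ Finset.Icc 1 (n + 1 + 1), y k
        = (∏ k ∈ Finset.Icc 1 n, t k) ^ 2 * t (n + 1) ^ 2 * t (n + 1 + 1) ^ 2 * v ^ (-(2 * C)) := by
      simp only [hy]
      rw [prod_mul_distrib, zprod, ← hC, hL, prod_pow]
    rw [eS, eZ, eY]
    have hT : ∏ k ∈ Finset.Icc 1 n, t k ≠ 0 := prod_ne_zero_iff.mpr htJ
    have ht1 : t (n + 1) ≠ 0 := htI _ (by simp)
    have ht2 : t (n + 1 + 1) ≠ 0 := ht _ (by simp)
    generalize ∏ k ∈ Finset.Icc 1 n, t k = T at *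
    have hvA := hvz A
    have hvB := hvz B
    have hvC := hvz C
    have d2 : ∀ e : ℤ, v ^ (2 * e) = (v ^ e) ^ 2 := fun e => by
      rw [mul_comm, zpow_mul]; norm_cast
    have w1 : v ^ (B - 2 * A + C - 1) = v ^ B * v ^ C / ((v ^ A) ^ 2 * v) := by
      rw [zpow_sub₀ hv, zpow_add₀ hv, zpow_sub₀ hv, d2, zpow_one]
      field_simp
    have w2 : v ^ (-B + 2 * A - C + 1) = (v ^ A) ^ 2 * v / (v ^ B * v ^ C) := by
      rw [zpow_add₀ hv, zpow_sub₀ hv, zpow_add₀ hv, d2, zpow_one, zpow_neg]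
      field_simp
    rw [w1, w2, zpow_sub₀ hv, zpow_neg, zpow_neg, zpow_neg, d2, d2, d2]
    have hv3 : v ^ 2 - 1 ≠ 0 := sub_ne_zero.mpr hv2
    have hv4 : v - v⁻¹ = (v ^ 2 - 1) / v := by field_simp
    rw [hv4]
    have hv5 : (1 - v ^ 2) = - (v ^ 2 - 1) := by ring
    rw [hv5]
    generalize v ^ A = x1 at *
    generalize v ^ B = x2 at *
    generalize v ^ C = x3 at *
    generalize hw : v ^ 2 - 1 = w at *
    field_simp
    ring
  · congr 1
    · refine sum_congr rfl fun j _ => ?_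
      rw [hL, prod_mul_distrib (s := Finset.Icc 1 n)]
      simp only [hs, hy, hz]
      ring
    · refine sum_congr rfl fun j _ => ?_
      rw [hL, prod_mul_distrib (s := Finset.Icc 1 n)]
      simp only [hs, hy, hz]
      ring
end

section
/- Let F be a field, let i ≥ 1 be an integer, let q ∈ F, let s_1, …, s_i be nonzero pairwise distinct elements of F with s_k ≠ q·s_j for all j ≠ k, and let p_1, …, p_{i-1}, r_1, …, r_{i+1} be elements of F. Then (1 − q)·(q·(s_1⋯s_i)^{-2}·(p_1⋯p_{i-1})·(r_1⋯r_{i+1}) − 1) = q·Σ_{j=1}^{i} s_j^{-2} ∏_{k=1}^{i+1}(s_j − r_k) ∏_{k=1}^{i-1}(p_k − q s_j) ∏_{k ≤ i, k ≠ j}(s_j − s_k)^{-1}(s_k − q s_j)^{-1} − Σ_{j=1}^{i} s_j^{-2} ∏_{k=1}^{i+1}(s_j − q r_k) ∏_{k=1}^{i-1}(p_k − s_j) ∏_{k ≤ i, k ≠ j}(s_j − q s_k)^{-1}(s_k − s_j)^{-1}. -/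
open Finset

namespace MrakAux

open Polynomial

lemma prod_erase_ite {ι M : Type*} [DecidableEq ι] [CommMonoid M] (s : Finset ι) (j : ι)
    (f : ι → M) : ∏ k ∈ s.erase j, f k = ∏ k ∈ s, if k = j then 1 else f k := by
  rw [← Finset.filter_ne' s j, Finset.prod_filter]
  exact Finset.prod_congr rfl fun k _ => by by_cases h : k = j <;> simp [h]

lemma lead {F ι : Type*} [Field F] [DecidableEq ι] (T : Finset ι) (v : ι → F)
    (hv : Set.InjOn v T) (A : F[X]) (hA : A.Monic) (hd : #T = A.natDegree + 1) :
    1 = ∑ i ∈ T, (A.eval (v i)) / ∏ j ∈ T.erase i, (v i - v j) := by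
  rw [← Lagrange.leadingCoeff_eq_sum hv, hA.leadingCoeff]
  rw [hd, Polynomial.degree_eq_natDegree hA.ne_zero]
  norm_cast

lemma natDegree_lin {F ι : Type*} [Field F] (T : Finset ι) (a : ι → F) :
    (∏ k ∈ T, (X - C (a k))).natDegree = #T := by
  simp

lemma key {F : Type*} [Field F] (I P R : Finset ℕ) (hR : #R = #I + 1) (hP : #P + 1 = #I)
    (q : F) (hq0 : q ≠ 0) (hq1 : q ≠ 1) (s p r : ℕ → F)
    (hs : ∀ j ∈ I, s j ≠ 0)
    (hdist : ∀ j ∈ I, ∀ k ∈ I, j ≠ k → s j ≠ s k)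
    (hq : ∀ j ∈ I, ∀ k ∈ I, j ≠ k → s k ≠ q * s j) :
    1 = (∏ k ∈ R, (0 - q * r k)) * (∏ k ∈ P, (0 - p k)) /
          ((∏ k ∈ I, (0 - s k)) * ∏ k ∈ I, (0 - q * s k)) +
      (∑ j ∈ I, (∏ k ∈ R, (s j - q * r k)) * (∏ k ∈ P, (s j - p k)) /
          (s j * ((∏ k ∈ I.erase j, (s j - s k)) * ∏ k ∈ I, (s j - q * s k))) +
       ∑ j ∈ I, (∏ k ∈ R, (q * s j - q * r k)) * (∏ k ∈ P, (q * s j - p k)) /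
          (q * s j * ((∏ k ∈ I, (q * s j - s k)) * ∏ k ∈ I.erase j, (q * s j - q * s k)))) := by
  classical
  have hne : ∀ j ∈ I, ∀ k ∈ I, s k ≠ q * s j := by
    intro j hj k hk h
    by_cases hjk : j = k
    · subst hjk
      have : (1 - q) * s j = 0 := by linear_combination h
      rcases mul_eq_zero.mp this with h1 | h1
      · exact hq1 (by linear_combination -h1)
      · exact hs j hj h1
    · exact hq j hj k hk hjk h
  let v : Option (ℕ ⊕ ℕ) → F := fun o => o.elim 0 (Sum.elim s (fun j => q * s j))
  have hm1 : (∏ k ∈ R, (X - C (q * r k))).Monic := monic_prod_X_sub_C _ _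
  have hm2 : (∏ k ∈ P, (X - C (p k))).Monic := monic_prod_X_sub_C _ _
  have := lead (insertNone (I.disjSum I)) v ?_
    ((∏ k ∈ R, (X - C (q * r k))) * ∏ k ∈ P, (X - C (p k))) (hm1.mul hm2) ?_
  · simp only [prod_erase_ite, sum_insertNone, prod_insertNone, sum_disjSum, prod_disjSum, v,
      eval_mul, eval_prod, eval_sub, eval_X, eval_C] at this ⊢
    simpa using this
  · rintro (_ | a | a) ha (_ | b | b) hb hab <;>
      simp only [Finset.mem_coe, none_mem_insertNone, some_mem_insertNone, inl_mem_disjSum,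
        inr_mem_disjSum] at ha hb <;>
      simp only [v, Option.elim, Sum.elim_inl, Sum.elim_inr] at hab
    · rfl
    · exact absurd hab.symm (hs b hb)
    · exact absurd hab.symm (mul_ne_zero hq0 (hs b hb))
    · exact absurd hab (hs a ha)
    · by_contra hc
      exact hdist a ha b hb (fun h => hc (by rw [h])) hab
    · exact absurd hab (hne b hb a ha)
    · exact absurd hab (mul_ne_zero hq0 (hs a ha))
    · exact absurd hab.symm (hne a ha b hb)
    · by_contra hc
      exact hdist a ha b hb (fun h => hc (by rw [h])) (mul_left_cancel₀ hq0 hab)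
  · rw [hm1.natDegree_mul hm2, natDegree_lin, natDegree_lin, card_insertNone, card_disjSum]
    omega

lemma prod_neg_swap {F : Type*} [Field F] (T : Finset ℕ) (a b : ℕ → F) :
    ∏ k ∈ T, (a k - b k) = (-1) ^ #T * ∏ k ∈ T, (b k - a k) := by
  rw [← Finset.prod_const, ← Finset.prod_mul_distrib]
  exact Finset.prod_congr rfl fun k _ => by ring

lemma main {F : Type*} [Field F] (I P R : Finset ℕ) (hR : #R = #I + 1) (hP : #P + 1 = #I)
    (q : F) (s p r : ℕ → F)
    (hs : ∀ j ∈ I, s j ≠ 0)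
    (hdist : ∀ j ∈ I, ∀ k ∈ I, j ≠ k → s j ≠ s k)
    (hq : ∀ j ∈ I, ∀ k ∈ I, j ≠ k → s k ≠ q * s j) :
    (1 - q) * (q * ((∏ j ∈ I, s j) ^ 2)⁻¹ * (∏ k ∈ P, p k) * (∏ k ∈ R, r k) - 1)
      = q * ∑ j ∈ I, ((s j) ^ 2)⁻¹ * (∏ k ∈ R, (s j - r k)) * (∏ k ∈ P, (p k - q * s j)) *
              (∏ k ∈ I.erase j, ((s j - s k)⁻¹ * (s k - q * s j)⁻¹))
        - ∑ j ∈ I, ((s j) ^ 2)⁻¹ * (∏ k ∈ R, (s j - q * r k)) * (∏ k ∈ P, (p k - s j)) *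
              (∏ k ∈ I.erase j, ((s j - q * s k)⁻¹ * (s k - s j)⁻¹)) := by
  have hcard : ∀ j ∈ I, #(I.erase j) = #P := fun j hj => by
    rw [card_erase_of_mem hj]; omega
  have hsq : ((-1 : F) ^ #P) * (-1) ^ #P = 1 := by
    rw [← mul_pow]; simp
  have he0 : ((-1 : F) ^ #P) ≠ 0 := pow_ne_zero _ (by simp)
  by_cases hq1 : q = 1
  · subst hq1
    simp only [sub_self, zero_mul, one_mul]
  by_cases hq0 : q = 0
  · subst hq0
    have h := lead I s (fun a ha b hb hab => by
      by_contra hc; exact hdist a ha b hb hc hab) (∏ k ∈ P, (X - C (p k)))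
      (monic_prod_X_sub_C _ _) (by rw [natDegree_lin]; omega)
    simp only [eval_prod, eval_sub, eval_X, eval_C] at h
    simp only [zero_mul, sub_zero, zero_sub, one_mul]
    rw [neg_inj, h]
    refine Finset.sum_congr rfl fun j hj => ?_
    have h0 := hs j hj
    rw [prod_mul_distrib, prod_const, prod_const, hcard j hj, hR, ← hP,
      prod_neg_swap P (fun _ => s j) p, Finset.prod_inv_distrib,
      prod_neg_swap _ (fun _ => s j) s, hcard j hj, mul_div_mul_left _ _ he0, inv_pow]
    field_simp
    ring
  have h := key I P R hR hP q hq0 hq1 s p r hs hdist hq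
  have hq1' : 1 - q ≠ 0 := sub_ne_zero.mpr (Ne.symm hq1)
  have e1 : (∏ k ∈ R, (0 - q * r k)) * (∏ k ∈ P, (0 - p k)) /
          ((∏ k ∈ I, (0 - s k)) * ∏ k ∈ I, (0 - q * s k)) =
        q * ((∏ j ∈ I, s j) ^ 2)⁻¹ * (∏ k ∈ P, p k) * (∏ k ∈ R, r k) := by
    have h0 : ∏ j ∈ I, s j ≠ 0 := Finset.prod_ne_zero_iff.mpr hs
    rw [prod_neg_swap R, prod_neg_swap P, prod_neg_swap I (fun _ => 0) s,
      prod_neg_swap I (fun _ => 0) (fun k => q * s k)]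
    simp only [sub_zero, prod_mul_distrib, prod_const, hR, ← hP]
    generalize (∏ j ∈ I, s j) = S at *
    field_simp
    ring
  have e2 : ∀ j ∈ I, (∏ k ∈ R, (s j - q * r k)) * (∏ k ∈ P, (s j - p k)) /
          (s j * ((∏ k ∈ I.erase j, (s j - s k)) * ∏ k ∈ I, (s j - q * s k))) =
        (1 - q)⁻¹ * (((s j) ^ 2)⁻¹ * (∏ k ∈ R, (s j - q * r k)) * (∏ k ∈ P, (p k - s j)) *
              (∏ k ∈ I.erase j, ((s j - q * s k)⁻¹ * (s k - s j)⁻¹))) := by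
    intro j hj
    have h0 := hs j hj
    rw [← mul_prod_erase I _ hj, prod_neg_swap P (fun _ => s j), prod_neg_swap (I.erase j) (fun _ => s j) s,
      hcard j hj, prod_mul_distrib, prod_inv_distrib, prod_inv_distrib]
    have h1 : ∏ k ∈ I.erase j, (s j - q * s k) ≠ 0 := Finset.prod_ne_zero_iff.mpr fun k hk =>
      sub_ne_zero.mpr (hq k (mem_of_mem_erase hk) j hj (ne_of_mem_erase hk))
    have h2 : ∏ k ∈ I.erase j, (s k - s j) ≠ 0 := Finset.prod_ne_zero_iff.mpr fun k hk =>
      sub_ne_zero.mpr (hdist k (mem_of_mem_erase hk) j hj (ne_of_mem_erase hk))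
    rw [show s j - q * s j = s j * (1 - q) by ring]
    field_simp
  have e3 : ∀ j ∈ I, (∏ k ∈ R, (q * s j - q * r k)) * (∏ k ∈ P, (q * s j - p k)) /
          (q * s j * ((∏ k ∈ I, (q * s j - s k)) * ∏ k ∈ I.erase j, (q * s j - q * s k))) =
        -(1 - q)⁻¹ * (q * (((s j) ^ 2)⁻¹ * (∏ k ∈ R, (s j - r k)) * (∏ k ∈ P, (p k - q * s j)) *
              (∏ k ∈ I.erase j, ((s j - s k)⁻¹ * (s k - q * s j)⁻¹)))) := by
    intro j hj
    have h0 := hs j hj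
    rw [← mul_prod_erase I _ hj, prod_neg_swap P (fun _ => q * s j),
      prod_neg_swap (I.erase j) (fun _ => q * s j) s,
      hcard j hj, prod_mul_distrib, prod_inv_distrib, prod_inv_distrib]
    simp only [← mul_sub]
    rw [prod_mul_distrib, prod_mul_distrib, prod_const, prod_const, hcard j hj, hR, ← hP]
    have h1 : ∏ k ∈ I.erase j, (s k - q * s j) ≠ 0 := Finset.prod_ne_zero_iff.mpr fun k hk =>
      sub_ne_zero.mpr (hq j hj k (mem_of_mem_erase hk) (ne_of_mem_erase hk).symm)
    have h2 : ∏ k ∈ I.erase j, (s j - s k) ≠ 0 := Finset.prod_ne_zero_iff.mpr fun k hk =>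
      sub_ne_zero.mpr (hdist j hj k (mem_of_mem_erase hk) (ne_of_mem_erase hk).symm)
    rw [show q * s j - s j = -(s j * (1 - q)) by ring]
    field_simp
    try ring
  rw [e1, Finset.sum_congr rfl e2, Finset.sum_congr rfl e3, ← Finset.mul_sum, ← Finset.mul_sum,
    ← Finset.mul_sum] at h
  have hi : (1 - q) * (1 - q)⁻¹ = 1 := mul_inv_cancel₀ hq1'
  generalize (∑ j ∈ I, ((s j) ^ 2)⁻¹ * (∏ k ∈ R, (s j - q * r k)) * (∏ k ∈ P, (p k - s j)) *
              (∏ k ∈ I.erase j, ((s j - q * s k)⁻¹ * (s k - s j)⁻¹))) = B at *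
  generalize (∑ j ∈ I, ((s j) ^ 2)⁻¹ * (∏ k ∈ R, (s j - r k)) * (∏ k ∈ P, (p k - q * s j)) *
              (∏ k ∈ I.erase j, ((s j - s k)⁻¹ * (s k - q * s j)⁻¹))) = A at *
  linear_combination (-(1 - q)) * h + (q * A - B) * hi

end MrakAux

/-- Reduced form of the key identity in the proof of Proposition 2.14 ('mrak')
of Braverman–Finkelberg, after the change of variables `q = v²`,
`s_j = t_j² v^{-2d_{i,j}}`, `r_k = t_k² v^{-2d_{i+1,k}}`,
`p_k = t_k² v^{-2d_{i-1,k}}`. -/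
theorem stmt_1 (F : Type*) [Field F] (i : ℕ) (hi : 1 ≤ i) (q : F)
    (s p r : ℕ → F)
    (hs : ∀ j ∈ Finset.Icc 1 i, s j ≠ 0)
    (hdist : ∀ j ∈ Finset.Icc 1 i, ∀ k ∈ Finset.Icc 1 i, j ≠ k → s j ≠ s k)
    (hq : ∀ j ∈ Finset.Icc 1 i, ∀ k ∈ Finset.Icc 1 i, j ≠ k → s k ≠ q * s j) :
    (1 - q) *
        (q * ((∏ j ∈ Finset.Icc 1 i, s j) ^ 2)⁻¹ *
            (∏ k ∈ Finset.Icc 1 (i - 1), p k) *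
            (∏ k ∈ Finset.Icc 1 (i + 1), r k) - 1)
      = q * ∑ j ∈ Finset.Icc 1 i,
            ((s j) ^ 2)⁻¹ * (∏ k ∈ Finset.Icc 1 (i + 1), (s j - r k)) *
              (∏ k ∈ Finset.Icc 1 (i - 1), (p k - q * s j)) *
              (∏ k ∈ (Finset.Icc 1 i).erase j,
                ((s j - s k)⁻¹ * (s k - q * s j)⁻¹))
        - ∑ j ∈ Finset.Icc 1 i,
            ((s j) ^ 2)⁻¹ * (∏ k ∈ Finset.Icc 1 (i + 1), (s j - q * r k)) *
              (∏ k ∈ Finset.Icc 1 (i - 1), (p k - s j)) *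
              (∏ k ∈ (Finset.Icc 1 i).erase j,
                ((s j - q * s k)⁻¹ * (s k - s j)⁻¹)) := by
  exact MrakAux.main (Finset.Icc 1 i) (Finset.Icc 1 (i - 1)) (Finset.Icc 1 (i + 1))
    (by simp) (by simp; omega) q s p r hs hdist hq
end
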